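/- arXiv:1602.04229 — 5 statements merged into one kernel-verified Lean document; each statement's English description precedes it below -/
import Mathlib

section
/- Let θ > 0, c > 0 and A > 0 be real numbers. Then the function g(p) = −(1/θ)·ln( (c/p)·e^{c/p}·E_A(c/p) ) is concave on (0, ∞), where E_A(x) = ∫_1^∞ e^{−x t}·t^{−A} dt. -/
open MeasureTheory

/-- The generalized exponential integral `E_A(x) = ∫_1^∞ e^{−x·t}·t^{−A} dt`. -/
noncomputable def expInt (A x : ℝ) : ℝ :=
  ∫ t in Set.Ioi (1 : ℝ), Real.exp (-x * t) * t ^ (-A)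

/-- Hölder's inequality for a function dominated by a weighted geometric mean. -/
theorem integral_le_rpow_mul_rpow_of_le {α : Type*} [MeasurableSpace α] {μ : Measure α}
    {u v w : α → ℝ} {a b : ℝ} (ha : 0 ≤ a) (hb : 0 ≤ b) (hab : a + b = 1)
    (hu : Integrable u μ) (hv : Integrable v μ) (hw : Integrable w μ)
    (hu0 : ∀ᵐ x ∂μ, 0 ≤ u x) (hv0 : ∀ᵐ x ∂μ, 0 ≤ v x)
    (hU : 0 < ∫ x, u x ∂μ) (hV : 0 < ∫ x, v x ∂μ)
    (hle : ∀ᵐ x ∂μ, w x ≤ u x ^ a * v x ^ b) :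
    ∫ x, w x ∂μ ≤ (∫ x, u x ∂μ) ^ a * (∫ x, v x ∂μ) ^ b := by
  set U := ∫ x, u x ∂μ with hUdef
  set V := ∫ x, v x ∂μ with hVdef
  have hint : Integrable (fun x => a * (u x / U) + b * (v x / V)) μ :=
    ((hu.div_const U).const_mul a).add ((hv.div_const V).const_mul b)
  have hone : ∫ x, (a * (u x / U) + b * (v x / V)) ∂μ = 1 := by
    rw [integral_add ((hu.div_const U).const_mul a) ((hv.div_const V).const_mul b),
      integral_const_mul, integral_const_mul, integral_div, integral_div, ← hUdef, ← hVdef,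
      div_self hU.ne', div_self hV.ne', mul_one, mul_one, hab]
  calc ∫ x, w x ∂μ ≤ ∫ x, U ^ a * V ^ b * (a * (u x / U) + b * (v x / V)) ∂μ := by
        refine integral_mono_ae hw (hint.const_mul _) ?_
        filter_upwards [hu0, hv0, hle] with x hux hvx hwx
        refine hwx.trans ?_
        have hy := Real.geom_mean_le_arith_mean2_weighted ha hb
          (div_nonneg hux hU.le) (div_nonneg hvx hV.le) hab
        have hUa : 0 < U ^ a := Real.rpow_pos_of_pos hU a
        have hVb : 0 < V ^ b := Real.rpow_pos_of_pos hV b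
        calc u x ^ a * v x ^ b = U ^ a * V ^ b * ((u x / U) ^ a * (v x / V) ^ b) := by
              rw [Real.div_rpow hux hU.le, Real.div_rpow hvx hV.le]
              field_simp
          _ ≤ _ := mul_le_mul_of_nonneg_left hy (by positivity)
    _ = U ^ a * V ^ b := by rw [integral_const_mul, hone, mul_one]

/-- The Laplace-type integral `∫_0^∞ e^{-s} (1 + s q)^{-A} ds`. -/
noncomputable def expMoment (A q : ℝ) : ℝ :=
  ∫ s in Set.Ioi (0 : ℝ), Real.exp (-s) * (1 + s * q) ^ (-A)

theorem integrableOn_expMoment {A q : ℝ} (hA : 0 ≤ A) (hq : 0 ≤ q) :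
    IntegrableOn (fun s : ℝ => Real.exp (-s) * (1 + s * q) ^ (-A)) (Set.Ioi 0) := by
  refine Integrable.mono' (integrableOn_exp_neg_Ioi 0)
    (by fun_prop : Measurable fun s : ℝ => Real.exp (-s) * (1 + s * q) ^ (-A)).aestronglyMeasurable ?_
  filter_upwards [ae_restrict_mem measurableSet_Ioi] with s hs
  have hs0 : (0 : ℝ) ≤ s * q := mul_nonneg (le_of_lt hs) hq
  rw [Real.norm_of_nonneg (by positivity)]
  exact mul_le_of_le_one_right (Real.exp_pos _).le
    (Real.rpow_le_one_of_one_le_of_nonpos (by linarith) (by linarith))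

theorem expMoment_pos {A q : ℝ} (hA : 0 ≤ A) (hq : 0 ≤ q) : 0 < expMoment A q := by
  have hpos : ∀ s ∈ Set.Ioi (0 : ℝ), 0 < Real.exp (-s) * (1 + s * q) ^ (-A) := fun s hs => by
    have hs0 : (0 : ℝ) ≤ s * q := mul_nonneg (le_of_lt hs) hq
    positivity
  rw [expMoment, setIntegral_pos_iff_support_of_nonneg_ae
    ((ae_restrict_iff' measurableSet_Ioi).2 (.of_forall fun s hs => (hpos s hs).le))
    (integrableOn_expMoment hA hq),
    Set.inter_eq_right.2 fun s hs => Function.mem_support.2 (hpos s hs).ne']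
  simp

/-- The moment `∫_0^∞ e^{-s} (1 + s q)^{-A} ds` is log-convex in `q`. -/
theorem expMoment_le_rpow_mul_rpow {A p q a b : ℝ} (hA : 0 ≤ A) (hp : 0 ≤ p) (hq : 0 ≤ q)
    (ha : 0 ≤ a) (hb : 0 ≤ b) (hab : a + b = 1) :
    expMoment A (a * p + b * q) ≤ expMoment A p ^ a * expMoment A q ^ b := by
  have hnonneg : ∀ r : ℝ, 0 ≤ r → ∀ᵐ s ∂(volume.restrict (Set.Ioi (0 : ℝ))),
      0 ≤ Real.exp (-s) * (1 + s * r) ^ (-A) := fun r hr => by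
    filter_upwards [ae_restrict_mem measurableSet_Ioi] with s hs
    have hs0 : (0 : ℝ) ≤ s * r := mul_nonneg (le_of_lt hs) hr
    positivity
  refine integral_le_rpow_mul_rpow_of_le ha hb hab (integrableOn_expMoment hA hp)
    (integrableOn_expMoment hA hq) (integrableOn_expMoment hA (by positivity))
    (hnonneg p hp) (hnonneg q hq) (expMoment_pos hA hp) (expMoment_pos hA hq) ?_
  filter_upwards [ae_restrict_mem measurableSet_Ioi] with s hs
  have hsp : 0 < 1 + s * p := by have := mul_nonneg (le_of_lt hs) hp; linarith
  have hsq : 0 < 1 + s * q := by have := mul_nonneg (le_of_lt hs) hq; linarith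
  have hexp : Real.exp (-s) = Real.exp (-s) ^ a * Real.exp (-s) ^ b := by
    rw [← Real.rpow_add (Real.exp_pos _), hab, Real.rpow_one]
  have hmean : (1 + s * p) ^ a * (1 + s * q) ^ b ≤ 1 + s * (a * p + b * q) := by
    refine (Real.geom_mean_le_arith_mean2_weighted ha hb hsp.le hsq.le hab).trans_eq ?_
    linear_combination hab
  rw [Real.mul_rpow (Real.exp_pos _).le (by positivity),
    Real.mul_rpow (Real.exp_pos _).le (by positivity), mul_mul_mul_comm, ← hexp]
  refine mul_le_mul_of_nonneg_left ?_ (Real.exp_pos _).le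
  refine (Real.rpow_le_rpow_of_nonpos (by positivity) hmean (by linarith)).trans_eq ?_
  rw [Real.mul_rpow (by positivity) (by positivity), ← Real.rpow_mul hsp.le,
    ← Real.rpow_mul hsq.le, ← Real.rpow_mul hsp.le, ← Real.rpow_mul hsq.le, mul_comm a,
    mul_comm b]

/-- The substitution `s = x (t - 1)` turns `x e^x E_A(x)` into an exponential moment. -/
theorem mul_exp_mul_expInt {A x : ℝ} (hx : 0 < x) :
    x * Real.exp x * expInt A x = expMoment A x⁻¹ := by
  have hshift : ∫ t in Set.Ioi (1 : ℝ), Real.exp (-x * t) * t ^ (-A)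
      = ∫ t in Set.Ioi (0 : ℝ), Real.exp (-x * (t + 1)) * (t + 1) ^ (-A) := by
    have h := (measurePreserving_add_right volume (1 : ℝ)).setIntegral_preimage_emb
      (measurableEmbedding_addRight 1) (fun t => Real.exp (-x * t) * t ^ (-A)) (Set.Ioi 1)
    simpa using h.symm
  have hscale := integral_comp_mul_left_Ioi
    (fun s => Real.exp (-s) * (1 + s * x⁻¹) ^ (-A)) 0 hx
  rw [mul_zero, smul_eq_mul, ← expMoment] at hscale
  rw [expInt, hshift, mul_assoc, ← integral_const_mul, ← eq_inv_mul_iff_mul_eq₀ hx.ne', ← hscale]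
  refine integral_congr_ae (.of_forall fun t => ?_)
  have h1 : 1 + x * t * x⁻¹ = t + 1 := by field_simp; ring
  simp only [h1]
  rw [← mul_assoc, ← Real.exp_add]
  congr 2
  ring

/-- For `θ, c, A > 0`, the per-subcarrier effective capacity
`g(p) = −(1/θ)·ln((c/p)·e^{c/p}·E_A(c/p))` is concave on `(0, ∞)`. -/
theorem stmt_8 (θ c A : ℝ) (hθ : 0 < θ) (hc : 0 < c) (hA : 0 < A) :
    ConcaveOn ℝ (Set.Ioi (0 : ℝ))
      (fun p => -(1 / θ) * Real.log ((c / p) * Real.exp (c / p) * expInt A (c / p))) := by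
  refine ⟨convex_Ioi 0, fun p hp q hq a b ha hb hab => ?_⟩
  have hr := convex_Ioi (0 : ℝ) hp hq ha hb hab
  simp only [Set.mem_Ioi, smul_eq_mul] at hp hq hr ⊢
  have hmom : ∀ y : ℝ, 0 < y →
      (c / y) * Real.exp (c / y) * expInt A (c / y) = expMoment A (y / c) := fun y hy => by
    rw [mul_exp_mul_expInt (div_pos hc hy), inv_div]
  rw [hmom p hp, hmom q hq, hmom _ hr]
  have hP := expMoment_pos hA.le (div_pos hp hc).le
  have hQ := expMoment_pos hA.le (div_pos hq hc).le
  have hlog := Real.log_le_log (expMoment_pos hA.le (div_pos hr hc).le)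
    ((congrArg (expMoment A) (by ring)).trans_le (expMoment_le_rpow_mul_rpow hA.le
      (div_pos hp hc).le (div_pos hq hc).le ha hb hab))
  rw [Real.log_mul (Real.rpow_pos_of_pos hP a).ne' (Real.rpow_pos_of_pos hQ b).ne',
    Real.log_rpow hP, Real.log_rpow hQ] at hlog
  have := mul_le_mul_of_nonneg_left hlog (one_div_pos.2 hθ).le
  linarith
end

section
/- Let S be a nonempty compact set in a topological space, and let f, g : S → ℝ be continuous with g(x) > 0 for all x ∈ S. Define F(q) = sup_{x ∈ S} (f(x) − q·g(x)) for q ∈ ℝ. Then F is strictly antitone: for all q₁ < q₂ one has F(q₂) < F(q₁). -/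
/-- Dinkelbach's parametric objective `F(q) = sup_{x ∈ S} (f x − q·g x)` over a nonempty
compact set `S` with `f, g` continuous and `g > 0` on `S` is strictly antitone. -/
theorem stmt_13 {X : Type*} [TopologicalSpace X]
    (S : Set X) (hS : S.Nonempty) (hSc : IsCompact S)
    (f g : X → ℝ) (hf : ContinuousOn f S) (hg : ContinuousOn g S)
    (hgpos : ∀ x ∈ S, 0 < g x)
    (F : ℝ → ℝ) (hF : ∀ q, F q = sSup ((fun x => f x - q * g x) '' S)) :
    StrictAnti F := by
  intro q₁ q₂ hq
  have hcont (q : ℝ) : ContinuousOn (fun x => f x - q * g x) S :=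
    hf.sub (continuousOn_const.mul hg)
  obtain ⟨x, hx, hsup⟩ := hSc.exists_sSup_image_eq hS (hcont q₂)
  calc F q₂ = f x - q₂ * g x := by rw [hF, hsup]
    _ < f x - q₁ * g x := sub_lt_sub_left (mul_lt_mul_of_pos_right hq (hgpos x hx)) _
    _ ≤ F q₁ := by
      rw [hF]
      exact le_csSup (hSc.bddAbove_image (hcont q₁)) ⟨x, hx, rfl⟩
end

section
/- Let S be a nonempty compact set in a topological space, f, g : S → ℝ continuous with g(x) > 0 on S, q* = sup_{x ∈ S} f(x)/g(x), and F(q) = sup_{x ∈ S} (f(x) − q·g(x)). Then for every q ∈ ℝ: F(q) > 0 if and only if q < q*; F(q) = 0 if and only if q = q*; and F(q) < 0 if and only if q > q*. -/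
/-- For Dinkelbach's method on the fractional program `max_{x ∈ S} f x / g x` with `S`
nonempty compact, `f, g` continuous and `g > 0` on `S`, with optimal ratio
`q* = sup_{x ∈ S} f x / g x` and parametric objective `F(q) = sup_{x ∈ S} (f x − q·g x)`:
`F(q) > 0 ↔ q < q*`, `F(q) = 0 ↔ q = q*`, and `F(q) < 0 ↔ q > q*`. -/
theorem stmt_15 {X : Type*} [TopologicalSpace X]
    (S : Set X) (hS : S.Nonempty) (hSc : IsCompact S)
    (f g : X → ℝ) (hf : ContinuousOn f S) (hg : ContinuousOn g S)
    (hgpos : ∀ x ∈ S, 0 < g x)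
    (qstar : ℝ) (hq : qstar = sSup ((fun x => f x / g x) '' S))
    (F : ℝ → ℝ) (hF : ∀ q, F q = sSup ((fun x => f x - q * g x) '' S)) :
    ∀ q : ℝ, (0 < F q ↔ q < qstar) ∧ (F q = 0 ↔ q = qstar) ∧ (F q < 0 ↔ qstar < q) := by
  intro q
  obtain ⟨x, hxS, hx, hxmax⟩ := hSc.exists_sSup_image_eq_and_ge hS
    (hf.div hg fun x hx => (hgpos x hx).ne')
  obtain ⟨y, hyS, hy, hymax⟩ := hSc.exists_sSup_image_eq_and_ge hS
    (hf.sub (continuousOn_const.mul hg : ContinuousOn (fun x => q * g x) S))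
  replace hx : qstar = f x / g x := hq.trans hx
  replace hy : F q = f y - q * g y := (hF q).trans hy
  have hyx : f y / g y ≤ qstar := (hxmax y hyS).trans_eq hx.symm
  have hxy : f x - q * g x ≤ F q := (hymax x hxS).trans_eq hy.symm
  have hpos : 0 < F q ↔ q < qstar := by
    constructor
    · intro h
      exact ((lt_div_iff₀ (hgpos y hyS)).2 (by linarith)).trans_le hyx
    · intro h
      rw [hx, lt_div_iff₀ (hgpos x hxS)] at h
      linarith
  have hneg : F q < 0 ↔ qstar < q := by
    constructor
    · intro h
      rw [hx, div_lt_iff₀ (hgpos x hxS)]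
      linarith
    · intro h
      have := (div_lt_iff₀ (hgpos y hyS)).1 (hyx.trans_lt h)
      linarith
  refine ⟨hpos, ?_, hneg⟩
  rw [eq_iff_le_not_lt, eq_iff_le_not_lt, ← not_lt, ← not_lt, hpos, hneg]
  tauto
end

section
/- Let S be a nonempty compact set in a topological space, f, g : S → ℝ continuous with g(x) > 0 on S, and q* = sup_{x ∈ S} f(x)/g(x). Then a point x₀ ∈ S satisfies f(x₀)/g(x₀) = q* (i.e., x₀ maximizes the ratio f/g over S) if and only if x₀ maximizes the function x ↦ f(x) − q*·g(x) over S and f(x₀) − q*·g(x₀) = 0. -/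
/-- For Dinkelbach's method on the fractional program `max_{x ∈ S} f x / g x` with `S`
nonempty compact, `f, g` continuous and `g > 0` on `S`, and optimal ratio
`q* = sup_{x ∈ S} f x / g x`: a point `x₀ ∈ S` attains `f x₀ / g x₀ = q*` if and only if
`x₀` maximizes `x ↦ f x − q*·g x` over `S` with optimal value `0`. -/
theorem stmt_16 {X : Type*} [TopologicalSpace X]
    (S : Set X) (hS : S.Nonempty) (hSc : IsCompact S)
    (f g : X → ℝ) (hf : ContinuousOn f S) (hg : ContinuousOn g S)
    (hgpos : ∀ x ∈ S, 0 < g x)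
    (qstar : ℝ) (hq : qstar = sSup ((fun x => f x / g x) '' S))
    (x₀ : X) (hx₀ : x₀ ∈ S) :
    f x₀ / g x₀ = qstar ↔
      ((∀ x ∈ S, f x - qstar * g x ≤ f x₀ - qstar * g x₀) ∧
        f x₀ - qstar * g x₀ = 0) := by
  have hbdd : BddAbove ((fun x => f x / g x) '' S) :=
    hSc.bddAbove_image (hf.div hg fun x hx => (hgpos x hx).ne')
  have hle : ∀ x ∈ S, f x - qstar * g x ≤ 0 := fun x hx =>
    sub_nonpos.2 <| (div_le_iff₀ (hgpos x hx)).1 <|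
      hq ▸ le_csSup hbdd (Set.mem_image_of_mem _ hx)
  rw [div_eq_iff (hgpos x₀ hx₀).ne', ← sub_eq_zero]
  exact ⟨fun h => ⟨fun x hx => h ▸ hle x hx, h⟩, And.right⟩
end

section
/- Let p, N₀, B, θ, T_f > 0 be real numbers and set A = θ·T_f·B / ln 2 and x = N₀·B/p. If g is a random variable distributed according to the exponential distribution with rate 1, then E[ exp( −θ·T_f·B·log₂(1 + g·p/(N₀·B)) ) ] = x·e^{x}·E_A(x), where E_A(x) = ∫_1^∞ e^{−x t}·t^{−A} dt. -/
open MeasureTheory ProbabilityTheory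

/-- Integration against the exponential distribution, in terms of its density. -/
lemma integral_expMeasure {r : ℝ} (hr : 0 < r) (f : ℝ → ℝ) :
    ∫ y, f y ∂(expMeasure r) = ∫ y in Set.Ioi (0 : ℝ), r * Real.exp (-(r * y)) * f y := by
  have hmeas : Measurable (gammaPDF 1 r) := (measurable_gammaPDFReal 1 r).ennreal_ofReal
  rw [expMeasure, gammaMeasure, integral_withDensity_eq_integral_toReal_smul hmeas
    (Filter.Eventually.of_forall fun _ ↦ ENNReal.ofReal_lt_top),
    ← integral_Ici_eq_integral_Ioi, ← integral_indicator measurableSet_Ici]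
  refine integral_congr_ae (Filter.Eventually.of_forall fun y ↦ ?_)
  simp only [gammaPDF]
  rw [ENNReal.toReal_ofReal (gammaPDFReal_nonneg one_pos hr y)]
  simp only [gammaPDFReal, Set.indicator_apply, Set.mem_Ici, smul_eq_mul]
  split_ifs <;> simp

/-- The substitution `t = 1 + y / x` in the generalized exponential integral. -/
lemma integral_exp_neg_mul_one_add_div_rpow (A : ℝ) {x : ℝ} (hx : 0 < x) :
    ∫ y in Set.Ioi (0 : ℝ), Real.exp (-y) * (1 + y / x) ^ (-A) =
      x * Real.exp x * expInt A x := by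
  have hscale := integral_comp_mul_left_Ioi
    (fun s ↦ Real.exp (-(x * s)) * (1 + s) ^ (-A)) 0 (inv_pos.mpr hx)
  have hshift := (measurePreserving_add_left volume (1 : ℝ)).setIntegral_preimage_emb
    (measurableEmbedding_addLeft 1) (fun t ↦ Real.exp (-x * t) * t ^ (-A)) (Set.Ioi 1)
  simp only [Set.preimage_const_add_Ioi, sub_self] at hshift
  rw [mul_zero, inv_inv, smul_eq_mul] at hscale
  have hexp (s : ℝ) : Real.exp (-(x * s)) * (1 + s) ^ (-A) =
      Real.exp x * (Real.exp (-x * (1 + s)) * (1 + s) ^ (-A)) := by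
    rw [← mul_assoc, ← Real.exp_add]
    ring_nf
  rw [expInt, ← hshift, mul_assoc, ← integral_const_mul]
  simpa only [← div_eq_inv_mul, mul_div_cancel₀ _ hx.ne', ← hexp] using hscale

/-- If the channel-power-gain `g` is exponentially distributed with unit rate
(NLOS Rayleigh fading), then with `A = θ·T_f·B/ln 2` and `x = N₀·B/p`,
`E[exp(−θ·T_f·B·log₂(1 + g·p/(N₀·B)))] = x·e^x·E_A(x)`. -/
theorem stmt_19 {Ω : Type*} [MeasurableSpace Ω] (μ : Measure Ω) [IsProbabilityMeasure μ]
    (p N₀ B θ Tf : ℝ) (hp : 0 < p) (hN₀ : 0 < N₀) (hB : 0 < B) (hθ : 0 < θ)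
    (hTf : 0 < Tf)
    (A x : ℝ) (hA : A = θ * Tf * B / Real.log 2) (hx : x = N₀ * B / p)
    (g : Ω → ℝ) (hgmeas : Measurable g) (hg : μ.map g = expMeasure 1) :
    ∫ ω, Real.exp (-θ * (Tf * B * Real.logb 2 (1 + g ω * p / (N₀ * B)))) ∂μ =
      x * Real.exp x * expInt A x := by
  have hx0 : 0 < x := hx ▸ by positivity
  have hf : Measurable fun y : ℝ ↦
      Real.exp (-θ * (Tf * B * Real.logb 2 (1 + y * p / (N₀ * B)))) := by
    unfold Real.logb
    fun_prop
  rw [← integral_map (f := fun y : ℝ ↦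
      Real.exp (-θ * (Tf * B * Real.logb 2 (1 + y * p / (N₀ * B)))))
    hgmeas.aemeasurable hf.aestronglyMeasurable, hg, integral_expMeasure one_pos,
    ← integral_exp_neg_mul_one_add_div_rpow A hx0]
  refine setIntegral_congr_fun measurableSet_Ioi fun y (hy : 0 < y) ↦ ?_
  have hyx : y * p / (N₀ * B) = y / x := by
    rw [hx, div_div_eq_mul_div]
  simp only [one_mul, hyx]
  rw [Real.rpow_def_of_pos (by positivity), hA, Real.logb]
  ring_nf
end
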